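/- There are no integers x, y, d with x ≥ 2, y ≥ 1, d ≥ 1 such that d = x³ − 2·x·y and 6·d + 36·y = −5·x³ + 77·x² − 181·x + 143. -/

import Mathlib

theorem no_solutions_P3_ell3 :
    ¬ ∃ x y d : ℤ, 2 ≤ x ∧ 1 ≤ y ∧ 1 ≤ d ∧ d = x ^ 3 - 2 * x * y ∧
      6 * d + 36 * y = -5 * x ^ 3 + 77 * x ^ 2 - 181 * x + 143 := by
  rintro ⟨x, y, d, hx, hy, hd, rfl, h⟩
  have hdvd : x - 3 ∣ 4 := ⟨12 * y - 11 * x ^ 2 + 44 * x - 49, by linarith⟩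
  have hle : x - 3 ≤ 4 := Int.le_of_dvd (by norm_num) hdvd
  have hx7 : x ≤ 7 := by linarith
  clear hdvd hle hd
  interval_cases x <;> omega
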